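/- Every maximal family is extremal: if F is a family of subsets of [n] with |F| = Σ_{i=0}^{VC(F)} C(n,i), then |Sh(F)| = |F|. Consequently, for all n ≥ 1 and k ≥ 0, m(n,k) ≤ ExVC(n,k). -/

import Mathlib

/-- `F` shatters `S` if every subset of `S` is the trace of a member of `F` on `S`. -/
def Shatters {n : ℕ} (F : Finset (Finset (Fin n))) (S : Finset (Fin n)) : Prop :=
  ∀ A ⊆ S, ∃ B ∈ F, B ∩ S = A

/-- The VC dimension of `F`: the maximum size of a set shattered by `F`. -/
noncomputable def vcDim {n : ℕ} (F : Finset (Finset (Fin n))) : ℕ :=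
  sSup {d : ℕ | ∃ S : Finset (Fin n), Shatters F S ∧ S.card = d}

/-- A family is maximal if its size attains the Sauer–Shelah bound for its VC dimension. -/
def IsMaximal {n : ℕ} (F : Finset (Finset (Fin n))) : Prop :=
  F.card = ∑ i ∈ Finset.range (vcDim F + 1), n.choose i

/-- `m(n,k)`: the number of maximal families in the power set of `[n]` of VC dimension
exactly `k`. -/
noncomputable def maxFamCount (n k : ℕ) : ℕ :=
  Nat.card {F : Finset (Finset (Fin n)) // IsMaximal F ∧ vcDim F = k}

/-- `ExVC(n,k)`: the number of shattering-extremal families (families `F` with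
`|Sh(F)| = |F|`) in the power set of `[n]` with VC dimension at most `k`. -/
noncomputable def exVC (n k : ℕ) : ℕ :=
  Nat.card {F : Finset (Finset (Fin n)) //
    Nat.card {S : Finset (Fin n) // Shatters F S} = F.card ∧ vcDim F ≤ k}

theorem shatters_iff_finset {n : ℕ} (F : Finset (Finset (Fin n))) (S : Finset (Fin n)) :
    Shatters F S ↔ F.Shatters S := by
  unfold Shatters Finset.Shatters
  constructor
  · intro h A hA
    obtain ⟨B, hB, e⟩ := h A hA
    exact ⟨B, hB, by rw [Finset.inter_comm]; exact e⟩
  · intro h A hA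
    obtain ⟨B, hB, e⟩ := h hA
    exact ⟨B, hB, by rw [Finset.inter_comm]; exact e⟩

theorem card_shattered_eq {n : ℕ} (F : Finset (Finset (Fin n))) :
    Nat.card {S : Finset (Fin n) // Shatters F S} = F.shatterer.card := by
  rw [← Nat.card_eq_finsetCard]
  exact Nat.card_congr (Equiv.subtypeEquivRight fun S => by
    rw [shatters_iff_finset, Finset.mem_shatterer])

theorem finset_vcDim_le {n : ℕ} (F : Finset (Finset (Fin n))) : F.vcDim ≤ vcDim F := by
  refine Finset.sup_le fun S hS => le_csSup ⟨n, ?_⟩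
    ⟨S, (shatters_iff_finset F S).2 (Finset.mem_shatterer.1 hS), rfl⟩
  rintro d ⟨T, _, rfl⟩
  simpa using Finset.card_le_univ T

theorem extremal_of_maximal (n : ℕ) (F : Finset (Finset (Fin n))) (hF : IsMaximal F) :
    Nat.card {S : Finset (Fin n) // Shatters F S} = F.card := by
  rw [card_shattered_eq]
  refine le_antisymm ?_ (Finset.card_le_card_shatterer F)
  rw [hF]
  refine Finset.card_shatterer_le_sum_vcDim.trans ?_
  rw [Fintype.card_fin]
  refine Finset.sum_le_sum_of_subset fun i hi => ?_
  have := finset_vcDim_le F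
  simp only [Finset.mem_Iic, Finset.mem_range] at *
  omega

/-- Every maximal family is shattering-extremal: if `|F| = ∑_{i=0}^{VC(F)} C(n,i)`, then
`|Sh(F)| = |F|`. Consequently, `m(n,k) ≤ ExVC(n,k)` for all `n ≥ 1`, `k ≥ 0`. -/
theorem maximal_implies_extremal :
    (∀ (n : ℕ) (F : Finset (Finset (Fin n))), IsMaximal F →
      Nat.card {S : Finset (Fin n) // Shatters F S} = F.card) ∧
    (∀ n k : ℕ, 1 ≤ n → maxFamCount n k ≤ exVC n k) := by
  refine ⟨extremal_of_maximal, fun n k _ => ?_⟩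
  exact Nat.card_le_card_of_injective
    (fun F => ⟨F.1, extremal_of_maximal n F.1 F.2.1, F.2.2.le⟩)
    (fun F G h => Subtype.ext (congrArg (fun x => x.1) h))
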